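/- arXiv:0906.5428 — 3 statements merged into one kernel-verified Lean document; each statement's English description precedes it below -/
import Mathlib

section
/- Let α be an irrational point of ℝ/ℤ. Then for every β ∈ ℚ/ℤ one has f_β(α) ≠ 0 if and only if β belongs to E_n(α) for some positive integer n. Moreover, if β belongs to E_n(α) then f_β(α) = (−1)^{n−1} q_{n−1}(α). -/
open MeasureTheory Filter Set

noncomputable section

/-- The normalized sawtooth function `ψ(x) = x - ⌊x⌋ - 1/2` for non-integer `x`,
and `ψ(x) = 0` for integer `x`.  It is periodic with period 1. -/
def saw (x : ℝ) : ℝ := if Int.fract x = 0 then 0 else Int.fract x - 1/2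

/-- For a rational `β = a/q` in lowest terms, the denominator `q'` of the left Farey
neighbour of `β` in the Farey fractions of order `q`:  the unique `q' ∈ {1, …, q-1}` with
`a * q' ≡ 1 (mod q)`. -/
def lden (β : ℚ) : ℕ := ((β.num : ZMod β.den)⁻¹).val

/-- The denominator `q''` of the right Farey neighbour of `β`:  the unique
`q'' ∈ {1, …, q-1}` with `a * q'' ≡ -1 (mod q)`. -/
def rden (β : ℚ) : ℕ := (((-β.num : ℤ) : ZMod β.den)⁻¹).val

/-- The left Farey neighbour `β'` of `β`:  the unique point of `F_{h(β)}` such that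
`{β', β}` are consecutive in `F_{h(β)}`.  Explicitly `β' = (a q' - 1)/(q q') = a'/q'`. -/
def lpt (β : ℚ) : ℚ := ((β.num * (lden β : ℤ) - 1 : ℤ) : ℚ) / ((β.den * lden β : ℕ) : ℚ)

/-- The right Farey neighbour `β''` of `β`:  the unique point of `F_{h(β)}` such that
`{β, β''}` are consecutive in `F_{h(β)}`.  Explicitly `β'' = (a q'' + 1)/(q q'') = a''/q''`.
(For `β ∈ (0,1)` one has `β' ∈ [0,β)` and `β'' ∈ (β,1]`; the rational `1` represents
the zero coset of `ℚ/ℤ`.) -/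
def rpt (β : ℚ) : ℚ := ((β.num * (rden β : ℤ) + 1 : ℤ) : ℚ) / ((β.den * rden β : ℕ) : ℚ)

/-- The function `f_β : ℝ/ℤ → ℝ` (realized as a 1-periodic function on `ℝ`), where
`β` ranges over rationals in `[0,1)` (representatives of `ℚ/ℤ`):  `f_0 ≡ 1` and, for
`β ≠ 0`, `f_β(x) = h(β) ψ(x-β) - h(β') ψ(x-β') - h(β'') ψ(x-β'')`, the height `h` of a
rational being its reduced denominator. -/
def fb (β : ℚ) (x : ℝ) : ℝ :=
  if β = 0 then 1 else
    (β.den : ℝ) * saw (x - (β : ℝ)) - ((lpt β).den : ℝ) * saw (x - ((lpt β : ℚ) : ℝ))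
      - ((rpt β).den : ℝ) * saw (x - ((rpt β : ℚ) : ℝ))

/-- The Farey fractions of order `Q` in `[0,1]` (both `0` and `1` represent the zero
coset of `ℚ/ℤ`). -/
def fareySet (Q : ℕ) : Set ℚ := {γ | 0 ≤ γ ∧ γ ≤ 1 ∧ γ.den ≤ Q}

/-- `{γ₁, γ₂}` are consecutive points of `F_Q`, i.e. `I(γ₁,γ₂) = (γ₁,γ₂)` is a component
interval of `(ℝ/ℤ) ∖ F_Q`. -/
def consec (Q : ℕ) (γ₁ γ₂ : ℚ) : Prop :=
  γ₁ ∈ fareySet Q ∧ γ₂ ∈ fareySet Q ∧ γ₁ < γ₂ ∧ ∀ γ ∈ fareySet Q, γ ≤ γ₁ ∨ γ₂ ≤ γ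

/-- The finite set `F_Q = {β ∈ ℚ/ℤ : h(β) ≤ Q}`, realized as the rationals in `[0,1)`
with denominator at most `Q`. -/
def fareyFin (Q : ℕ) : Finset ℚ :=
  ((Finset.range (Q+1) ×ˢ Finset.range (Q+1)).image fun p => (p.1 : ℚ) / (p.2 : ℚ)).filter
    fun β => 0 ≤ β ∧ β < 1 ∧ β.den ≤ Q

/-- The Gauss map `x ↦ {1/x}`. -/
def gaussMap (x : ℝ) : ℝ := Int.fract x⁻¹

/-- `cfa α n` is the `n`-th partial quotient `a_n` of the continued fraction expansion
`α = [0; a₁, a₂, …]` of `α ∈ (0,1)` (with the convention `a₀ = 0`). -/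
def cfa (α : ℝ) : ℕ → ℤ
  | 0 => 0
  | n+1 => ⌊(gaussMap^[n] α)⁻¹⌋

/-- `cfpq α (n+2) = (pₙ, qₙ)`, the numerators and denominators of the principal
convergents of `α`:  `p₋₂ = 0, q₋₂ = 1, p₋₁ = 1, q₋₁ = 0`,
`pₙ = aₙ pₙ₋₁ + pₙ₋₂`, `qₙ = aₙ qₙ₋₁ + qₙ₋₂`. -/
def cfpq (α : ℝ) : ℕ → ℤ × ℤ
  | 0 => (0, 1)
  | 1 => (1, 0)
  | n+2 => (cfa α n * (cfpq α (n+1)).1 + (cfpq α n).1,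
            cfa α n * (cfpq α (n+1)).2 + (cfpq α n).2)

/-- The element `(m pₙ₋₁ + pₙ₋₂)/(m qₙ₋₁ + qₙ₋₂)` of `E_n(α)`, reduced modulo 1 to the
representative in `[0,1)` of its coset in `ℚ/ℤ`. -/
def cfE (α : ℝ) (n : ℕ) (m : ℤ) : ℚ :=
  Int.fract (((m * (cfpq α (n+1)).1 + (cfpq α n).1 : ℤ) : ℚ) /
             ((m * (cfpq α (n+1)).2 + (cfpq α n).2 : ℤ) : ℚ))

/-- `E_n(α) = {(m pₙ₋₁ + pₙ₋₂)/(m qₙ₋₁ + qₙ₋₂) : 1 ≤ m ≤ aₙ}`, the set of the `n`-th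
principal convergent together with the intermediate convergents, as a finite set of
representatives in `[0,1)` of elements of `ℚ/ℤ`. -/
def cfEfin (α : ℝ) (n : ℕ) : Finset ℚ := (Finset.Icc 1 (cfa α n)).image (cfE α n)


/-- `fareyForm α v = qα - p` for `v = (p, q)`; its sign tells on which side of `p/q` the point
`α` lies. -/
def fareyForm (α : ℝ) (v : ℤ × ℤ) : ℝ := v.2 * α - v.1

lemma fareyForm_add (α : ℝ) (v w : ℤ × ℤ) :
    fareyForm α (v + w) = fareyForm α v + fareyForm α w := by
  simp only [fareyForm, Prod.fst_add, Prod.snd_add]; push_cast; ring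

lemma fareyForm_sub (α : ℝ) (v w : ℤ × ℤ) :
    fareyForm α (v - w) = fareyForm α v - fareyForm α w := by
  simp only [fareyForm, Prod.fst_sub, Prod.snd_sub]; push_cast; ring

lemma fareyForm_zsmul (α : ℝ) (m : ℤ) (v : ℤ × ℤ) :
    fareyForm α (m • v) = m * fareyForm α v := by
  simp only [fareyForm, Prod.smul_fst, Prod.smul_snd, smul_eq_mul]; push_cast; ring

/-! ### The sawtooth function and Farey neighbours -/

lemma saw_sub_ratCast {α : ℝ} (hα : α ∈ Set.Ioo (0:ℝ) 1) (hirr : Irrational α) {γ : ℚ}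
    (h0 : 0 ≤ γ) (h1 : γ ≤ 1) :
    saw (α - γ) = α - γ - 1/2 + if α < γ then 1 else 0 := by
  have h0' : (0:ℝ) ≤ γ := by exact_mod_cast h0
  have h1' : (γ:ℝ) ≤ 1 := by exact_mod_cast h1
  have hne : α ≠ γ := fun h => hirr ⟨γ, h.symm⟩
  obtain ⟨ha, hb⟩ := hα
  unfold saw
  split_ifs with hf hlt hlt
  · exact absurd (Int.fract_eq_zero_iff.mp hf)
      (by rintro ⟨z, hz⟩; exact (hirr.sub_ratCast γ) ⟨z, by simpa using hz⟩)
  · exact absurd (Int.fract_eq_zero_iff.mp hf)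
      (by rintro ⟨z, hz⟩; exact (hirr.sub_ratCast γ) ⟨z, by simpa using hz⟩)
  · have : Int.fract (α - γ) = α - γ + 1 :=
      Int.fract_eq_iff.mpr ⟨by linarith, by linarith, -1, by push_cast; ring⟩
    rw [this]; ring
  · have hlt' : (γ:ℝ) < α := lt_of_le_of_ne (not_lt.mp hlt) hne.symm
    have : Int.fract (α - γ) = α - γ :=
      Int.fract_eq_iff.mpr ⟨by linarith, by linarith, 0, by push_cast; ring⟩
    rw [this]; ring

lemma den_mul_saw {α : ℝ} (hα : α ∈ Set.Ioo (0:ℝ) 1) (hirr : Irrational α) {γ : ℚ} {v : ℤ × ℤ}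
    (hγ : γ = v.1 / v.2) (hv : IsCoprime v.1 v.2) (h : 0 < v.2) (h0 : 0 ≤ v.1) (h1 : v.1 ≤ v.2) :
    (γ.den : ℝ) * saw (α - γ)
      = fareyForm α v - v.2 / 2 + if fareyForm α v < 0 then (v.2 : ℝ) else 0 := by
  have hden : (γ.den : ℤ) = v.2 := by
    rw [hγ]; exact Rat.den_div_eq_of_coprime h (Int.isCoprime_iff_nat_coprime.mp hv)
  have hq : (0:ℚ) < v.2 := by exact_mod_cast h
  have hr : (0:ℝ) < v.2 := by exact_mod_cast h
  have hden' : (γ.den : ℝ) = v.2 := by exact_mod_cast hden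
  have hγr : (γ : ℝ) = v.1 / v.2 := by rw [hγ]; push_cast; rfl
  have hlt : α < γ ↔ fareyForm α v < 0 := by
    rw [hγr, lt_div_iff₀ hr, fareyForm, sub_neg, mul_comm]
  rw [saw_sub_ratCast hα hirr (hγ ▸ div_nonneg (by exact_mod_cast h0) hq.le)
    (by rw [hγ, div_le_one hq]; exact_mod_cast h1), hden', hγr]
  simp only [← hγr, hlt]
  have hmul : (v.2 : ℝ) * (v.1 / v.2) = v.1 := mul_div_cancel₀ _ hr.ne'
  rw [hγr, fareyForm]
  split_ifs <;> linear_combination -hmul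

lemma zmod_inv_val_spec {q : ℕ} (hq : 1 < q) {a : ℤ} (h : IsCoprime a q) :
    0 < ((a : ZMod q)⁻¹).val ∧ ((a : ZMod q)⁻¹).val < q ∧
      (q : ℤ) ∣ a * ((a : ZMod q)⁻¹).val - 1 := by
  have : NeZero q := ⟨by omega⟩
  have : Fact (1 < q) := ⟨hq⟩
  have hu : (a : ZMod q) * (a : ZMod q)⁻¹ = 1 := ZMod.coe_int_mul_inv_eq_one h
  refine ⟨Nat.pos_of_ne_zero fun h0 => ?_, ZMod.val_lt _, ?_⟩
  · rw [ZMod.val_eq_zero] at h0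
    simp [h0] at hu
  · rw [← ZMod.intCast_zmod_eq_zero_iff_dvd]
    push_cast
    rw [ZMod.natCast_zmod_val, hu, sub_self]

/-- The left Farey neighbour `w = (a', q')` of `v = (a, q)` determines `f_{a/q}` at irrational
points: with `β'' = (a - a')/(q - q')` the right neighbour, `f_{a/q}` is
`q·1[α < β] - q'·1[α < β'] - q''·1[α < β'']`. -/
lemma exists_left_neighbour {β : ℚ} (h0 : 0 < β) (h1 : β < 1) :
    ∃ w : ℤ × ℤ, 0 < w.2 ∧ w.2 < β.den ∧ β.num * w.2 - w.1 * β.den = 1 ∧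
      ∀ α : ℝ, α ∈ Set.Ioo (0:ℝ) 1 → Irrational α →
        fb β α = (if fareyForm α (β.num, β.den) < 0 then (β.den : ℝ) else 0)
          - (if fareyForm α w < 0 then (w.2 : ℝ) else 0)
          - (if fareyForm α ((β.num, (β.den : ℤ)) - w) < 0 then (β.den : ℝ) - w.2 else 0) := by
  have hcop : IsCoprime β.num (β.den : ℤ) := Rat.isCoprime_num_den β
  have hn0 : 0 < β.num := Rat.num_pos.mpr h0
  have hnd : β.num < β.den := Rat.num_lt_denom_iff.mpr h1
  have hd1 : 1 < β.den := by omega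
  obtain ⟨hl0, hlq, c, hc⟩ := zmod_inv_val_spec hd1 hcop
  obtain ⟨hr0, hrq, e, he⟩ := zmod_inv_val_spec hd1 hcop.neg_left
  change 0 < lden β at hl0
  change lden β < _ at hlq
  change _ * (lden β : ℤ) - 1 = _ at hc
  change 0 < rden β at hr0
  change rden β < _ at hrq
  change _ * (rden β : ℤ) - 1 = _ at he
  set a := β.num with ha
  set q := β.den with hq
  set l := lden β with hl
  set r := rden β with hr
  have hsum : (l : ℤ) + r = q := by
    have hdvd : (q : ℤ) ∣ l + r :=
      hcop.symm.dvd_of_dvd_mul_left ⟨c - e, by linear_combination hc - he⟩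
    obtain ⟨k, hk⟩ := hdvd
    have hk0 : 0 < k := by
      by_contra hneg
      nlinarith
    have hk2 : k < 2 := by
      by_contra hneg
      nlinarith
    have : k = 1 := by omega
    rw [hk, this, mul_one]
  have hqpos : (0:ℤ) < q := by omega
  have hc0 : 0 ≤ c := by
    by_contra hneg
    nlinarith
  have hcl : c ≤ l := by
    by_contra hneg
    nlinarith
  have hdet : a * l - c * q = 1 := by linear_combination hc
  refine ⟨(c, l), Int.natCast_pos.mpr hl0, Int.ofNat_lt.mpr hlq, hdet, fun α hα hirr => ?_⟩
  have hqQ : (q : ℚ) ≠ 0 := by positivity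
  have hlpt : lpt β = ((c, (l : ℤ)) : ℤ × ℤ).1 / ((c, (l : ℤ)) : ℤ × ℤ).2 := by
    have hc' : (a * l - 1 : ℚ) = q * c := by exact_mod_cast hc
    unfold lpt
    rw [← ha, ← hq, ← hl]
    push_cast
    rw [hc', mul_div_mul_left _ _ hqQ]
  have hrpt : rpt β = ((a - c, (r : ℤ)) : ℤ × ℤ).1 / ((a - c, (r : ℤ)) : ℤ × ℤ).2 := by
    have hc' : (a * r + 1 : ℚ) = q * (a - c) := by
      have : (a * r + 1 : ℤ) = q * (a - c) := by rw [eq_sub_of_add_eq' hsum]; linear_combination -hc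
      exact_mod_cast this
    unfold rpt
    rw [← ha, ← hq, ← hr]
    push_cast
    rw [hc', mul_div_mul_left _ _ hqQ]
  have hβ : β = ((a, (q : ℤ)) : ℤ × ℤ).1 / ((a, (q : ℤ)) : ℤ × ℤ).2 := by
    push_cast; exact (Rat.num_div_den β).symm
  have hsub : ((a, (q : ℤ)) : ℤ × ℤ) - (c, (l : ℤ)) = (a - c, (r : ℤ)) := by
    ext <;> simp; omega
  have hrdet : (a - c) * q - a * r = 1 := by rw [eq_sub_of_add_eq' hsum]; linear_combination hc
  have hac0 : 0 ≤ a - c := by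
    by_contra hneg
    nlinarith
  have hacr : a - c ≤ r := by
    by_contra hneg
    nlinarith
  have hsumr : (r : ℝ) = q - l := by
    have : (l : ℝ) + r = q := by exact_mod_cast hsum
    linarith
  have hform : fareyForm α (a - c, (r : ℤ))
      = fareyForm α (a, (q : ℤ)) - fareyForm α (c, (l : ℤ)) := by
    rw [← hsub, fareyForm_sub]
  rw [fb, if_neg h0.ne',
    den_mul_saw hα hirr hβ hcop hqpos hn0.le hnd.le,
    den_mul_saw hα hirr hlpt ⟨-q, a, by linear_combination hdet⟩ (Int.natCast_pos.mpr hl0) hc0 hcl,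
    den_mul_saw hα hirr hrpt ⟨q, -a, by linear_combination hrdet⟩ (Int.natCast_pos.mpr hr0)
      hac0 hacr,
    hsub]
  simp only [Int.cast_natCast, hsumr, hform]
  ring

lemma farey_left_unique {a q a₁ q₁ a₂ q₂ : ℤ} (h₁ : a * q₁ - a₁ * q = 1)
    (h₂ : a * q₂ - a₂ * q = 1) (hq₁ : 0 < q₁ ∧ q₁ < q) (hq₂ : 0 < q₂ ∧ q₂ < q) :
    a₁ = a₂ ∧ q₁ = q₂ := by
  have hcop : IsCoprime q a := ⟨-a₁, q₁, by linear_combination h₁⟩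
  have hdvd : q ∣ q₁ - q₂ :=
    hcop.dvd_of_dvd_mul_left ⟨a₁ - a₂, by linear_combination h₁ - h₂⟩
  have hz : q₁ - q₂ = 0 := Int.eq_zero_of_abs_lt_dvd hdvd (by rw [abs_lt]; omega)
  have hq : q₁ = q₂ := by omega
  refine ⟨mul_right_cancel₀ (b := q) (by omega) ?_, hq⟩
  subst hq
  linear_combination h₂ - h₁

/-! ### Convergents -/

section Convergents

variable {α : ℝ}

lemma gaussMap_iterate_mem (hα : α ∈ Set.Ioo (0:ℝ) 1) (hirr : Irrational α) (n : ℕ) :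
    gaussMap^[n] α ∈ Set.Ioo (0:ℝ) 1 ∧ Irrational (gaussMap^[n] α) := by
  induction n with
  | zero => exact ⟨hα, hirr⟩
  | succ n ih =>
    rw [Function.iterate_succ_apply']
    have hi : Irrational (gaussMap (gaussMap^[n] α)) := by
      unfold gaussMap Int.fract
      exact (irrational_inv_iff.mpr ih.2).sub_intCast _
    exact ⟨⟨lt_of_le_of_ne (Int.fract_nonneg _) hi.ne_zero.symm, Int.fract_lt_one _⟩, hi⟩

lemma one_le_cfa (hα : α ∈ Set.Ioo (0:ℝ) 1) (hirr : Irrational α) (n : ℕ) :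
    1 ≤ cfa α (n + 1) := by
  obtain ⟨⟨h0, h1⟩, -⟩ := gaussMap_iterate_mem hα hirr n
  rw [cfa, Int.le_floor]
  exact_mod_cast (one_le_inv₀ h0).mpr h1.le

lemma cfpq_add_two (α : ℝ) (n : ℕ) :
    cfpq α (n + 2) = cfa α n • cfpq α (n + 1) + cfpq α n := by
  rw [cfpq]; rfl

lemma fareyForm_cfpq_succ (hα : α ∈ Set.Ioo (0:ℝ) 1) (hirr : Irrational α) (n : ℕ) :
    fareyForm α (cfpq α (n + 2)) = -gaussMap^[n] α * fareyForm α (cfpq α (n + 1)) := by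
  induction n with
  | zero => simp [fareyForm, cfpq, cfa]
  | succ n ih =>
    have hne : gaussMap^[n] α ≠ 0 := (gaussMap_iterate_mem hα hirr n).1.1.ne'
    rw [cfpq_add_two, fareyForm_add, fareyForm_zsmul, ih, Function.iterate_succ_apply',
      gaussMap, Int.fract, cfa]
    field_simp
    ring

lemma fareyForm_cfpq_sign (hα : α ∈ Set.Ioo (0:ℝ) 1) (hirr : Irrational α) (n : ℕ) :
    0 < (-1) ^ n * fareyForm α (cfpq α n) := by
  induction n using Nat.strong_induction_on with
  | _ n ih =>
    match n with
    | 0 => simpa [fareyForm, cfpq] using hα.1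
    | 1 => simp [fareyForm, cfpq]
    | n + 2 =>
      rw [fareyForm_cfpq_succ hα hirr]
      have := mul_pos (gaussMap_iterate_mem hα hirr n).1.1 (ih (n + 1) (by omega))
      calc _ < _ := this
        _ = _ := by ring

lemma cfpq_det (α : ℝ) (n : ℕ) :
    (cfpq α (n + 1)).1 * (cfpq α n).2 - (cfpq α n).1 * (cfpq α (n + 1)).2 = (-1) ^ n := by
  induction n with
  | zero => simp [cfpq]
  | succ n ih =>
    rw [cfpq_add_two, pow_succ, ← ih]
    simp only [Prod.fst_add, Prod.snd_add, Prod.smul_fst, Prod.smul_snd, smul_eq_mul]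
    ring

lemma cfpq_bounds (hα : α ∈ Set.Ioo (0:ℝ) 1) (hirr : Irrational α) (n : ℕ) :
    0 ≤ (cfpq α (n + 2)).1 ∧ (cfpq α (n + 2)).1 ≤ (cfpq α (n + 2)).2 ∧
      1 ≤ (cfpq α (n + 2)).2 := by
  induction n using Nat.strong_induction_on with
  | _ n ih =>
    match n with
    | 0 => simp [cfpq, cfa]
    | 1 =>
      have := one_le_cfa hα hirr 0
      simpa [cfpq, cfa] using this
    | n + 2 =>
      have h1 := ih (n + 1) (by omega)
      have h0 := ih n (by omega)
      have ha := one_le_cfa hα hirr (n + 1)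
      rw [cfpq_add_two]
      simp only [Prod.fst_add, Prod.snd_add, Prod.smul_fst, Prod.smul_snd, smul_eq_mul]
      refine ⟨?_, ?_, ?_⟩ <;> nlinarith

/-- The vector `(m pₙ₋₁ + pₙ₋₂, m qₙ₋₁ + qₙ₋₂)` of an intermediate convergent. -/
def cfMid (α : ℝ) (n : ℕ) (m : ℤ) : ℤ × ℤ := m • cfpq α (n + 1) + cfpq α n

lemma cfE_eq (α : ℝ) (n : ℕ) (m : ℤ) :
    cfE α n m = Int.fract (((cfMid α n m).1 : ℚ) / ((cfMid α n m).2 : ℚ)) := rfl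

lemma fareyForm_cfMid_sign (hα : α ∈ Set.Ioo (0:ℝ) 1) (hirr : Irrational α) {n : ℕ} {m : ℤ}
    (hm : m ≤ cfa α n) : 0 < (-1) ^ n * fareyForm α (cfMid α n m) := by
  have h1 := fareyForm_cfpq_sign hα hirr (n + 1)
  have h2 := fareyForm_cfpq_sign hα hirr (n + 2)
  rw [cfpq_add_two, fareyForm_add, fareyForm_zsmul] at h2
  rw [cfMid, fareyForm_add, fareyForm_zsmul]
  have hm' : (0:ℝ) ≤ cfa α n - m := by exact_mod_cast sub_nonneg.mpr hm
  have := mul_nonneg hm' h1.le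
  rw [pow_succ] at this
  rw [pow_add] at h2
  linarith

lemma cfMid_det (α : ℝ) (n : ℕ) (m : ℤ) :
    (cfMid α n m).1 * (cfpq α (n + 1)).2 - (cfpq α (n + 1)).1 * (cfMid α n m).2
      = -(-1) ^ n := by
  rw [← cfpq_det α n, cfMid]
  simp only [Prod.fst_add, Prod.snd_add, Prod.smul_fst, Prod.smul_snd, smul_eq_mul]
  ring

/-- Two Farey neighbours enclosing `α`, the second of larger height, are a convergent and
an intermediate convergent of `α`. -/
lemma exists_eq_cfMid (hα : α ∈ Set.Ioo (0:ℝ) 1) (hirr : Irrational α) (v w : ℤ × ℤ)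
    (hw : 0 < w.2) (hdet : |v.1 * w.2 - w.1 * v.2| = 1)
    (hlt : w.2 < v.2 ∨ w.2 = v.2 ∧ w.1 < v.1)
    (hform : fareyForm α w * fareyForm α v < 0) :
    ∃ n : ℕ, ∃ m : ℤ, 1 ≤ n ∧ 1 ≤ m ∧ m ≤ cfa α n ∧ w = cfpq α (n + 1) ∧ v = cfMid α n m := by
  induction hN : v.2.toNat using Nat.strong_induction_on generalizing v w with
  | _ N ih =>
  rcases hlt with hlt | ⟨heq, hlt⟩
  · have hform' : fareyForm α w * fareyForm α (v - w) < 0 := by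
      rw [fareyForm_sub]; nlinarith [sq_nonneg (fareyForm α w)]
    have hdet' : |(v - w).1 * w.2 - w.1 * (v - w).2| = 1 := by
      rw [← hdet, Prod.fst_sub, Prod.snd_sub]; ring_nf
    have hdet'' : |w.1 * (v - w).2 - (v - w).1 * w.2| = 1 := by rw [abs_sub_comm]; exact hdet'
    by_cases hlex : w.2 < (v - w).2 ∨ w.2 = (v - w).2 ∧ w.1 < (v - w).1
    · obtain ⟨n, m, hn, hm, hma, hwn, hvn⟩ := ih _ (by simp; omega) (v - w) w hw hdet' hlex
        hform' rfl
      have hv : v = cfMid α n (m + 1) := by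
        rw [← sub_add_cancel v w, hvn, hwn, cfMid, cfMid, add_smul, one_smul]; abel
      refine ⟨n, m + 1, hn, by omega, ?_, hwn, hv⟩
      by_contra hgt
      have hm' : m = cfa α n := by omega
      have hv' : v = cfpq α (n + 2) + w := by
        rw [cfpq_add_two, ← hm', ← sub_add_cancel v w, hvn, hwn]; rfl
      rw [hv', fareyForm_add, hwn, fareyForm_cfpq_succ hα hirr] at hform
      have hθ := sub_pos.mpr (gaussMap_iterate_mem hα hirr n).1.2
      nlinarith [mul_nonneg hθ.le (sq_nonneg (fareyForm α (cfpq α (n + 1))))]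
    · have hne : ¬ (w.2 = (v - w).2 ∧ w.1 = (v - w).1) := by
        rintro ⟨h2, h1⟩
        rw [← h1, ← h2] at hdet'
        simp at hdet'
      have hlex' : (v - w).2 < w.2 ∨ (v - w).2 = w.2 ∧ (v - w).1 < w.1 := by
        omega
      obtain ⟨n, m, hn, hm, hma, hwn, hvn⟩ := ih _ (by omega) w (v - w) (by simp; omega)
        hdet'' hlex' (by rwa [mul_comm]) rfl
      have hv : v = cfMid α n (m + 1) := by
        rw [← sub_add_cancel v w, hwn, hvn, cfMid, cfMid, add_smul, one_smul]; abel
      have hm' : m = cfa α n := by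
        by_contra hgt
        have h1 := fareyForm_cfMid_sign hα hirr hma
        have h2 := fareyForm_cfMid_sign hα hirr (n := n) (m := m + 1) (by omega)
        rw [← hvn] at h1
        rw [← hv] at h2
        rcases neg_one_pow_eq_or ℝ n with h | h <;> rw [h] at h1 h2 <;> nlinarith
      have hw' : w = cfpq α (n + 2) := by rw [hvn, hm', cfpq_add_two]; rfl
      refine ⟨n + 1, 1, by omega, le_rfl, one_le_cfa hα hirr n, hw', ?_⟩
      rw [cfMid, one_smul, ← hw', ← hwn]; abel
  · have hw1 : w.2 = 1 ∧ v.1 - w.1 = 1 := by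
      rw [← heq, ← sub_mul, abs_of_pos (mul_pos (by omega) hw)] at hdet
      have := Int.eq_one_or_neg_one_of_mul_eq_one' hdet
      omega
    obtain ⟨hw2, hvw⟩ := hw1
    have hv1 : v.1 = w.1 + 1 := by omega
    have hw0 : w.1 = 0 := by
      simp only [fareyForm, ← heq, hw2, hv1] at hform
      push_cast at hform
      have hfl : ⌊α⌋ = w.1 := by
        rw [Int.floor_eq_iff]
        constructor <;> nlinarith
      rw [← hfl]
      exact Int.floor_eq_zero_iff.mpr ⟨hα.1.le, hα.2⟩
    refine ⟨1, 1, le_rfl, le_rfl, one_le_cfa hα hirr 0, ?_, ?_⟩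
    · ext <;> simp [cfpq, cfa, hw0, hw2]
    · ext <;> simp [cfMid, cfpq, cfa, hv1, hw0, ← heq, hw2]

lemma fb_cfE (hα : α ∈ Set.Ioo (0:ℝ) 1) (hirr : Irrational α) {n : ℕ} (hn : 1 ≤ n) {m : ℤ}
    (hm : 1 ≤ m) (hma : m ≤ cfa α n) :
    fb (cfE α n m) α = (-1 : ℝ) ^ (n - 1) * ((cfpq α (n + 1)).2 : ℝ) := by
  obtain ⟨n, rfl⟩ := Nat.exists_eq_add_of_le' hn
  by_cases hbase : n = 0 ∧ m = 1
  · obtain ⟨rfl, rfl⟩ := hbase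
    simp [cfE, cfpq, cfa, fb]
  obtain ⟨hp0, hpq, hq1⟩ := cfpq_bounds hα hirr n
  have hmid : 0 ≤ (cfMid α (n + 1) m).1 ∧ (cfMid α (n + 1) m).1 ≤ (cfMid α (n + 1) m).2 ∧
      (cfpq α (n + 2)).2 < (cfMid α (n + 1) m).2 := by
    rw [cfMid]
    simp only [Prod.fst_add, Prod.snd_add, Prod.smul_fst, Prod.smul_snd, smul_eq_mul]
    cases n with
    | zero =>
      simp [cfpq, cfa] at hbase ⊢
      omega
    | succ n =>
      obtain ⟨hp0', hpq', hq1'⟩ := cfpq_bounds hα hirr n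
      refine ⟨?_, ?_, ?_⟩ <;> nlinarith
  have hdet := cfMid_det α (n + 1) m
  have hsgn := fareyForm_cfMid_sign hα hirr hma
  have hsgn' := fareyForm_cfpq_sign hα hirr (n + 2)
  have hE := cfE_eq α (n + 1) m
  set v := cfMid α (n + 1) m
  set u := cfpq α (n + 2)
  obtain ⟨hv0, hvle, huv⟩ := hmid
  have hcop : IsCoprime v.1 v.2 := by
    rcases neg_one_pow_eq_or ℤ (n + 1) with h | h <;> rw [h] at hdet
    · exact ⟨-u.2, u.1, by linear_combination -hdet⟩
    · exact ⟨u.2, -u.1, by linear_combination hdet⟩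
  have hv2 : ¬ IsUnit v.2 := by rw [Int.isUnit_iff]; omega
  have hv0' : 0 < v.1 := lt_of_le_of_ne hv0 fun h => hv2 (isCoprime_zero_left.mp (h ▸ hcop))
  have hvlt : v.1 < v.2 := lt_of_le_of_ne hvle fun h => hv2 (isCoprime_self.mp (h ▸ hcop))
  have hv2pos : 0 < v.2 := by omega
  have hv2Q : (0:ℚ) < v.2 := by exact_mod_cast hv2pos
  have hβ0 : (0:ℚ) < v.1 / v.2 := div_pos (by exact_mod_cast hv0') hv2Q
  have hβ1 : (v.1 / v.2 : ℚ) < 1 := (div_lt_one hv2Q).mpr (by exact_mod_cast hvlt)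
  rw [Int.fract_eq_self.mpr ⟨hβ0.le, hβ1⟩] at hE
  have hnum : (cfE α (n + 1) m).num = v.1 := by
    rw [hE]; exact Rat.num_div_eq_of_coprime hv2pos (Int.isCoprime_iff_nat_coprime.mp hcop)
  have hden : ((cfE α (n + 1) m).den : ℤ) = v.2 := by
    rw [hE]; exact Rat.den_div_eq_of_coprime hv2pos (Int.isCoprime_iff_nat_coprime.mp hcop)
  rw [← hE] at hβ0 hβ1
  obtain ⟨w, hw0, hwlt, hwdet, hf⟩ := exists_left_neighbour hβ0 hβ1
  rw [hf α hα hirr]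
  have hdenR : ((cfE α (n + 1) m).den : ℝ) = v.2 := by exact_mod_cast hden
  rw [hnum, hden] at *
  rw [hdenR, Prod.mk.eta, Nat.add_sub_cancel]
  rw [pow_succ] at hsgn hdet
  rw [pow_add] at hsgn'
  rcases Nat.even_or_odd n with hpar | hpar
  · simp only [hpar.neg_one_pow] at hsgn hsgn' hdet ⊢
    obtain ⟨h1, h2⟩ := farey_left_unique hwdet (a₂ := u.1) (q₂ := u.2)
      (by linear_combination hdet) ⟨hw0, hwlt⟩ ⟨by omega, huv⟩
    have hwu : w = u := Prod.ext h1 h2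
    rw [hwu, fareyForm_sub, if_pos (by linarith), if_neg (by linarith), if_pos (by linarith)]
    ring
  · simp only [hpar.neg_one_pow] at hsgn hsgn' hdet ⊢
    obtain ⟨h1, h2⟩ := farey_left_unique hwdet (a₂ := v.1 - u.1) (q₂ := v.2 - u.2)
      (by linear_combination -hdet) ⟨hw0, hwlt⟩ ⟨by omega, by omega⟩
    have hwu : w = v - u := Prod.ext h1 h2
    rw [hwu, sub_sub_cancel, fareyForm_sub, if_neg (by linarith), if_neg (by linarith),
      if_pos (by linarith), Prod.snd_sub]
    push_cast
    ring

lemma exists_mem_cfEfin_of_fb_ne_zero (hα : α ∈ Set.Ioo (0:ℝ) 1) (hirr : Irrational α) {β : ℚ}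
    (hβ : β ∈ Set.Ico (0:ℚ) 1) (hfb : fb β α ≠ 0) : ∃ n : ℕ, 1 ≤ n ∧ β ∈ cfEfin α n := by
  rcases hβ.1.eq_or_lt with rfl | h0
  · refine ⟨1, le_rfl, Finset.mem_image.mpr
      ⟨1, Finset.mem_Icc.mpr ⟨le_rfl, one_le_cfa hα hirr 0⟩, ?_⟩⟩
    simp [cfE, cfpq, cfa]
  obtain ⟨w, hw0, hwlt, hdet, hf⟩ := exists_left_neighbour h0 hβ.2
  rw [hf α hα hirr] at hfb
  suffices h : ∃ n : ℕ, ∃ m : ℤ, 1 ≤ n ∧ 1 ≤ m ∧ m ≤ cfa α n ∧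
      (β.num, (β.den : ℤ)) = cfMid α n m by
    obtain ⟨n, m, hn, hm, hma, hv⟩ := h
    refine ⟨n, hn, Finset.mem_image.mpr ⟨m, Finset.mem_Icc.mpr ⟨hm, hma⟩, ?_⟩⟩
    rw [cfE_eq, ← hv, Int.cast_natCast, Rat.num_div_den]
    exact Int.fract_eq_self.mpr hβ
  have hform_ne : ∀ v : ℤ × ℤ, v.2 ≠ 0 → fareyForm α v ≠ 0 := fun v hv h =>
    ((hirr.intCast_mul hv).sub_intCast v.1).ne_zero h
  have hv_ne := hform_ne (β.num, (β.den : ℤ)) (by simp)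
  have hw_ne := hform_ne w hw0.ne'
  have hu_ne := hform_ne ((β.num, (β.den : ℤ)) - w) (by simp; omega)
  have hsub := fareyForm_sub α (β.num, (β.den : ℤ)) w
  have hw0R : (0:ℝ) < w.2 := by exact_mod_cast hw0
  have hwltR : (w.2 : ℝ) < β.den := by exact_mod_cast hwlt
  have hid : β.den * fareyForm α w - w.2 * fareyForm α (β.num, (β.den : ℤ)) = 1 := by
    have hdetR : (β.num * w.2 - w.1 * β.den : ℝ) = 1 := by exact_mod_cast hdet
    simp only [fareyForm, Int.cast_natCast]
    linear_combination hdetR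
  rcases hv_ne.lt_or_gt with hv | hv
  · rcases hw_ne.lt_or_gt with hw | hw
    · exfalso
      have hu : fareyForm α ((β.num, (β.den : ℤ)) - w) < 0 := by
        rw [hsub] at hu_ne ⊢
        nlinarith
      rw [if_pos hv, if_pos hw, if_pos hu] at hfb
      exact hfb (by ring)
    · obtain ⟨n, m, hn, hm, hma, -, h⟩ := exists_eq_cfMid hα hirr (β.num, (β.den : ℤ)) w hw0
        (by simp [hdet]) (Or.inl hwlt) (mul_neg_of_pos_of_neg hw hv)
      exact ⟨n, m, hn, hm, hma, h⟩
  · have hw : 0 < fareyForm α w := by nlinarith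
    have hu : fareyForm α ((β.num, (β.den : ℤ)) - w) < 0 := by
      by_contra hu
      rw [if_neg hv.not_gt, if_neg hw.not_gt, if_neg hu] at hfb
      exact hfb (by ring)
    obtain ⟨n, m, hn, hm, hma, -, h⟩ := exists_eq_cfMid hα hirr (β.num, (β.den : ℤ))
      ((β.num, (β.den : ℤ)) - w) (by simp; omega)
      (by
        rw [Prod.fst_sub, Prod.snd_sub, abs_eq one_pos.le]
        exact Or.inr (by linear_combination -hdet))
      (Or.inl (by simp; omega)) (mul_neg_of_neg_of_pos hu hv)
    exact ⟨n, m, hn, hm, hma, h⟩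

end Convergents

/-- **Theorem 1 (Haynes–Vaaler).**  Let `α` be an irrational point of `ℝ/ℤ` (realized as an
irrational `α ∈ (0,1)`).  For every `β ∈ ℚ/ℤ` (realized as a rational in `[0,1)`) one has
`f_β(α) ≠ 0` iff `β ∈ E_n(α)` for some `n ≥ 1`; moreover if `β ∈ E_n(α)` then
`f_β(α) = (-1)^(n-1) q_{n-1}(α)`. -/
theorem fb_ne_zero_iff_mem_convergents (α : ℝ) (hα : α ∈ Set.Ioo (0:ℝ) 1)
    (hirr : Irrational α) :
    (∀ β : ℚ, β ∈ Set.Ico (0:ℚ) 1 →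
      (fb β α ≠ 0 ↔ ∃ n : ℕ, 1 ≤ n ∧ β ∈ cfEfin α n)) ∧
    (∀ β : ℚ, ∀ n : ℕ, 1 ≤ n → β ∈ cfEfin α n →
      fb β α = (-1 : ℝ)^(n-1) * ((cfpq α (n+1)).2 : ℝ)) := by
  refine ⟨fun β hβ => ⟨exists_mem_cfEfin_of_fb_ne_zero hα hirr hβ, ?_⟩, ?_⟩
  · rintro ⟨n, hn, hmem⟩
    obtain ⟨m, hm, rfl⟩ := Finset.mem_image.mp hmem
    rw [Finset.mem_Icc] at hm
    rw [fb_cfE hα hirr hn hm.1 hm.2]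
    obtain ⟨n, rfl⟩ := Nat.exists_eq_add_of_le' hn
    have hq : (cfpq α (n + 2)).2 ≠ 0 := by have := (cfpq_bounds hα hirr n).2.2; omega
    exact mul_ne_zero (by simp) (by exact_mod_cast hq)
  · intro β n hn hmem
    obtain ⟨m, hm, rfl⟩ := Finset.mem_image.mp hmem
    rw [Finset.mem_Icc] at hm
    exact fb_cfE hα hirr hn hm.1 hm.2
end
end

section
/- Suppose that β and γ are distinct nonzero points in ℚ/ℤ with h(β) ≤ h(γ). Then exactly one of the following three alternatives holds: I(γ′, γ″) ⊆ I(β′, β), or I(γ′, γ″) ⊆ I(β, β″), or I(β′, β″) ∩ I(γ′, γ″) = ∅. -/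
open MeasureTheory Filter Set

noncomputable section

theorem one_lt_den_of_mem_Ioo {β : ℚ} (hβ : β ∈ Set.Ioo (0:ℚ) 1) : 1 < β.den := by
  have h0 : 0 < β.num := Rat.num_pos.2 hβ.1
  have h1 : β.num < β.den := Rat.num_lt_denom_iff.2 hβ.2
  omega

theorem lden_pos {β : ℚ} (hβ : 1 < β.den) : 0 < lden β := by
  have : Fact (1 < β.den) := ⟨hβ⟩
  have hu : (β.num : ZMod β.den) * (β.num : ZMod β.den)⁻¹ = 1 :=
    ZMod.coe_int_mul_inv_eq_one β.isCoprime_num_den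
  rw [lden, Nat.pos_iff_ne_zero, Ne, ZMod.val_eq_zero]
  intro h
  rw [h, mul_zero] at hu
  exact zero_ne_one hu

theorem lden_lt_den (β : ℚ) : lden β < β.den :=
  have : NeZero β.den := ⟨β.den_nz⟩
  ZMod.val_lt _

theorem exists_num_mul_lden (β : ℚ) : ∃ a : ℤ, β.num * lden β - 1 = β.den * a := by
  have hu : (β.num : ZMod β.den) * (β.num : ZMod β.den)⁻¹ = 1 :=
    ZMod.coe_int_mul_inv_eq_one β.isCoprime_num_den
  have : NeZero β.den := ⟨β.den_nz⟩
  refine (ZMod.intCast_zmod_eq_zero_iff_dvd _ β.den).1 ?_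
  simp [lden, hu]

theorem exists_lpt_eq (β : ℚ) :
    ∃ a : ℤ, β.num * lden β - 1 = β.den * a ∧ lpt β = (a : ℚ) / (lden β : ℚ) := by
  obtain ⟨a, ha⟩ := exists_num_mul_lden β
  refine ⟨a, ha, ?_⟩
  have h1 : (β.den : ℚ) ≠ 0 := by positivity
  rw [lpt, ha]
  push_cast
  exact mul_div_mul_left _ _ h1

theorem lpt_den_lt {β : ℚ} (hβ : 1 < β.den) : (lpt β).den < β.den := by
  obtain ⟨a, -, ha⟩ := exists_lpt_eq β
  have hd : (lpt β).den ∣ lden β := by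
    have h := Rat.den_dvd a (lden β)
    rw [Rat.divInt_eq_div] at h
    rw [ha]
    exact_mod_cast h
  exact (Nat.le_of_dvd (lden_pos hβ) hd).trans_lt (lden_lt_den β)

theorem lpt_lt {β : ℚ} (hβ : 1 < β.den) : lpt β < β := by
  obtain ⟨a, h, ha⟩ := exists_lpt_eq β
  have h1 : (0 : ℚ) < lden β := mod_cast lden_pos hβ
  have h2 : (0 : ℚ) < β.den := mod_cast β.den_pos
  have h' : (β.num * lden β - 1 : ℚ) = β.den * a := mod_cast h
  rw [ha]
  nth_rw 2 [← Rat.num_div_den β]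
  rw [div_lt_div_iff₀ h1 h2]
  linarith

/-- No rational of denominator at most that of `γ` lies strictly between `lpt γ` and `γ`. -/
theorem le_lpt_of_lt {γ r : ℚ} (hγ : 1 < γ.den) (hr : r.den ≤ γ.den) (h : r < γ) :
    r ≤ lpt γ := by
  obtain ⟨a, h1, ha⟩ := exists_lpt_eq γ
  have hq := lden_pos hγ
  by_contra! hlt
  rw [ha, ← Rat.num_div_den r,
    div_lt_div_iff₀ (mod_cast hq) (mod_cast r.den_pos)] at hlt
  have h2 : r.num * γ.den < γ.num * r.den := Rat.lt_iff _ _ |>.1 h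
  have h3 : a * r.den < r.num * lden γ := mod_cast hlt
  have h4 : (0 : ℤ) < lden γ := mod_cast hq
  have h5 : (r.den : ℤ) ≤ γ.den := mod_cast hr
  have h6 : (0 : ℤ) < γ.den := mod_cast γ.den_pos
  have h7 : (lden γ : ℤ) * (γ.num * r.den - r.num * γ.den)
      + γ.den * (r.num * lden γ - a * r.den) = r.den := by
    linear_combination (r.den : ℤ) * h1
  nlinarith [mul_le_mul_of_nonneg_left (Int.add_one_le_iff.2 h2) h4.le,
    mul_le_mul_of_nonneg_left (Int.add_one_le_iff.2 h3) h6.le]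

theorem rden_eq_lden_neg (β : ℚ) : rden β = lden (-β) := rfl

theorem rpt_eq_neg_lpt_neg (β : ℚ) : rpt β = -lpt (-β) := by
  rw [rpt, lpt, rden_eq_lden_neg, Rat.neg_num, Rat.neg_den, ← neg_div]
  push_cast
  ring

theorem rpt_den_lt {β : ℚ} (hβ : 1 < β.den) : (rpt β).den < β.den := by
  rw [rpt_eq_neg_lpt_neg, Rat.neg_den]
  exact lpt_den_lt (β := -β) hβ

theorem lt_rpt {β : ℚ} (hβ : 1 < β.den) : β < rpt β := by
  rw [rpt_eq_neg_lpt_neg]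
  exact lt_neg_of_lt_neg (lpt_lt (β := -β) hβ)

/-- No rational of denominator at most that of `γ` lies strictly between `γ` and `rpt γ`. -/
theorem rpt_le_of_lt {γ r : ℚ} (hγ : 1 < γ.den) (hr : r.den ≤ γ.den) (h : γ < r) :
    rpt γ ≤ r := by
  rw [rpt_eq_neg_lpt_neg]
  exact neg_le_of_neg_le (le_lpt_of_lt (γ := -γ) (r := -r) hγ hr (neg_lt_neg h))

theorem le_lpt_or_rpt_le {γ r : ℚ} (hγ : 1 < γ.den) (hr : r.den ≤ γ.den) (h : r ≠ γ) :
    r ≤ lpt γ ∨ rpt γ ≤ r :=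
  h.lt_or_gt.imp (le_lpt_of_lt hγ hr) (rpt_le_of_lt hγ hr)

/-- **Lemma 1 (Haynes–Vaaler).**  If `β` and `γ` are distinct nonzero points of `ℚ/ℤ`
(realized as rationals in `(0,1)`) with `h(β) ≤ h(γ)`, then exactly one of the following
holds: `I(γ',γ'') ⊆ I(β',β)`, or `I(γ',γ'') ⊆ I(β,β'')`, or `I(β',β'') ∩ I(γ',γ'') = ∅`. -/
theorem farey_interval_trichotomy (β γ : ℚ) (hβ : β ∈ Set.Ioo (0:ℚ) 1)
    (hγ : γ ∈ Set.Ioo (0:ℚ) 1) (hne : β ≠ γ) (hle : β.den ≤ γ.den) :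
    (Set.Ioo ((lpt γ : ℚ) : ℝ) ((rpt γ : ℚ) : ℝ) ⊆ Set.Ioo ((lpt β : ℚ) : ℝ) ((β : ℚ) : ℝ) ∧
      ¬ Set.Ioo ((lpt γ : ℚ) : ℝ) ((rpt γ : ℚ) : ℝ) ⊆ Set.Ioo ((β : ℚ) : ℝ) ((rpt β : ℚ) : ℝ) ∧
      ¬ Set.Ioo ((lpt β : ℚ) : ℝ) ((rpt β : ℚ) : ℝ) ∩
          Set.Ioo ((lpt γ : ℚ) : ℝ) ((rpt γ : ℚ) : ℝ) = ∅) ∨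
    (¬ Set.Ioo ((lpt γ : ℚ) : ℝ) ((rpt γ : ℚ) : ℝ) ⊆ Set.Ioo ((lpt β : ℚ) : ℝ) ((β : ℚ) : ℝ) ∧
      Set.Ioo ((lpt γ : ℚ) : ℝ) ((rpt γ : ℚ) : ℝ) ⊆ Set.Ioo ((β : ℚ) : ℝ) ((rpt β : ℚ) : ℝ) ∧
      ¬ Set.Ioo ((lpt β : ℚ) : ℝ) ((rpt β : ℚ) : ℝ) ∩
          Set.Ioo ((lpt γ : ℚ) : ℝ) ((rpt γ : ℚ) : ℝ) = ∅) ∨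
    (¬ Set.Ioo ((lpt γ : ℚ) : ℝ) ((rpt γ : ℚ) : ℝ) ⊆ Set.Ioo ((lpt β : ℚ) : ℝ) ((β : ℚ) : ℝ) ∧
      ¬ Set.Ioo ((lpt γ : ℚ) : ℝ) ((rpt γ : ℚ) : ℝ) ⊆ Set.Ioo ((β : ℚ) : ℝ) ((rpt β : ℚ) : ℝ) ∧
      Set.Ioo ((lpt β : ℚ) : ℝ) ((rpt β : ℚ) : ℝ) ∩
          Set.Ioo ((lpt γ : ℚ) : ℝ) ((rpt γ : ℚ) : ℝ) = ∅) := by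
  have hb := one_lt_den_of_mem_Ioo hβ
  have hg := one_lt_den_of_mem_Ioo hγ
  have hl := lpt_den_lt hb
  have hr := rpt_den_lt hb
  have hlb : ((lpt β : ℚ) : ℝ) < (β : ℝ) := mod_cast lpt_lt hb
  have hbr : (β : ℝ) < ((rpt β : ℚ) : ℝ) := mod_cast lt_rpt hb
  have hlg : ((lpt γ : ℚ) : ℝ) < (γ : ℝ) := mod_cast lpt_lt hg
  have hgr : (γ : ℝ) < ((rpt γ : ℚ) : ℝ) := mod_cast lt_rpt hg
  have h1 : (β : ℝ) ≤ (lpt γ : ℚ) ∨ ((rpt γ : ℚ) : ℝ) ≤ β :=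
    mod_cast le_lpt_or_rpt_le hg hle hne
  have h2 : ((lpt β : ℚ) : ℝ) ≤ (lpt γ : ℚ) ∨ ((rpt γ : ℚ) : ℝ) ≤ (lpt β : ℚ) :=
    mod_cast le_lpt_or_rpt_le hg (hl.le.trans hle) (fun h => by rw [h] at hl; omega)
  have h3 : ((rpt β : ℚ) : ℝ) ≤ (lpt γ : ℚ) ∨ ((rpt γ : ℚ) : ℝ) ≤ (rpt β : ℚ) :=
    mod_cast le_lpt_or_rpt_le hg (hr.le.trans hle) (fun h => by rw [h] at hr; omega)
  rw [Set.Ioo_subset_Ioo_iff (hlg.trans hgr), Set.Ioo_subset_Ioo_iff (hlg.trans hgr),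
    Set.Ioo_inter_Ioo, Set.Ioo_eq_empty_iff, sup_lt_iff, lt_inf_iff, lt_inf_iff]
  grind
end
end

section
/- Let β₁, β₂, … be an enumeration of ℚ/ℤ. Then the enumeration is admissible if and only if for each positive integer n the function f_{β_n} is measurable with respect to the σ-algebra B_n. -/
open MeasureTheory Filter Set

noncomputable section

/-- `e` (restricted to indices `n ≥ 1`) is an enumeration `β₁, β₂, …` of `ℚ/ℤ`
(whose elements are realized as the rationals in `[0,1)`). -/
def IsEnumeration (e : ℕ → ℚ) : Prop :=
  (∀ n, 1 ≤ n → e n ∈ Set.Ico (0:ℚ) 1) ∧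
  (∀ m n, 1 ≤ m → 1 ≤ n → e m = e n → m = n) ∧
  (∀ β ∈ Set.Ico (0:ℚ) 1, ∃ n, 1 ≤ n ∧ e n = β)

/-- The enumeration `β₁, β₂, …` is admissible: `β₁ = 0`, and for `m ≥ 2`, `β_k = β_m'`
implies `k < m` and `β_l = β_m''` implies `l < m`.  (`Int.fract` reduces the Farey
neighbours, which lie in `[0,1]`, to their coset representatives in `[0,1)`.) -/
def IsAdmissible (e : ℕ → ℚ) : Prop :=
  e 1 = 0 ∧
  (∀ m, 2 ≤ m → ∀ k, 1 ≤ k → e k = Int.fract (lpt (e m)) → k < m) ∧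
  (∀ m, 2 ≤ m → ∀ l, 1 ≤ l → e l = Int.fract (rpt (e m)) → l < m)

/-- `J` is a connected component of `(ℝ/ℤ) ∖ S`, for a finite set `S` of points of `ℚ/ℤ`
realized as rationals in `[0,1)`; the circle `ℝ/ℤ` is realized as `[0,1) ⊆ ℝ`.  Either
`J` is an open interval between two points of `S` consecutive in `[0,1)`, or `J` is the
wrap-around component running from the largest point of `S` through `0` to the smallest
point of `S`. -/
def isCircComponent (S : Finset ℚ) (J : Set ℝ) : Prop :=
  (∃ a ∈ S, ∃ b ∈ S, a < b ∧ (∀ c ∈ S, c ≤ a ∨ b ≤ c) ∧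
      J = Set.Ioo ((a : ℚ) : ℝ) ((b : ℚ) : ℝ)) ∨
  (∃ a ∈ S, ∃ b ∈ S, (∀ c ∈ S, b ≤ c ∧ c ≤ a) ∧
      J = Set.Ioo ((a : ℚ) : ℝ) 1 ∪ Set.Ico 0 ((b : ℚ) : ℝ))

/-- The finite σ-algebra `B_n` generated by the components of `(ℝ/ℤ) ∖ {β₁, …, β_n}`
together with the singletons `{β₁}, …, {β_n}` (as a σ-algebra of subsets of `ℝ`; its
trace on `[0,1) ≅ ℝ/ℤ` is the σ-algebra of the paper). -/
def bsig (e : ℕ → ℚ) (n : ℕ) : MeasurableSpace ℝ :=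
  MeasurableSpace.generateFrom
    ({J | isCircComponent ((Finset.Icc 1 n).image e) J} ∪
     {J | ∃ k, 1 ≤ k ∧ k ≤ n ∧ J = {((e k : ℚ) : ℝ)}})

theorem saw_sub_fract (x d : ℝ) : saw (x - Int.fract d) = saw (x - d) := by
  have : x - Int.fract d = x - d + (⌊d⌋ : ℤ) := by rw [Int.fract]; ring
  rw [this, saw, saw, Int.fract_add_intCast]

theorem saw_of_lt {x c : ℝ} (hx : x ∈ Ico (0:ℝ) 1) (hc : c ∈ Ico (0:ℝ) 1) (h : c < x) :
    saw (x - c) = x - c - 1 / 2 := by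
  have : Int.fract (x - c) = x - c :=
    Int.fract_eq_self.2 ⟨by linarith, by linarith [hx.2, hc.1]⟩
  rw [saw, this, if_neg (by linarith)]

theorem saw_of_gt {x c : ℝ} (hx : x ∈ Ico (0:ℝ) 1) (hc : c ∈ Ico (0:ℝ) 1) (h : x < c) :
    saw (x - c) = x - c + 1 / 2 := by
  have : Int.fract (x - c) = x - c + 1 := by
    rw [← Int.fract_add_one]
    exact Int.fract_eq_self.2 ⟨by linarith [hx.1, hc.2], by linarith⟩
  rw [saw, this, if_neg (by linarith [hx.1, hc.2])]
  ring

theorem saw_sub_saw_of_same_side {x y c : ℝ} (hx : x ∈ Ico (0:ℝ) 1) (hy : y ∈ Ico (0:ℝ) 1)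
    (hc : c ∈ Ico (0:ℝ) 1) (h : (c < x ∧ c < y) ∨ (x < c ∧ y < c)) :
    saw (x - c) - saw (y - c) = x - y := by
  rcases h with ⟨h, h'⟩ | ⟨h, h'⟩
  · rw [saw_of_lt hx hc h, saw_of_lt hy hc h']; ring
  · rw [saw_of_gt hx hc h, saw_of_gt hy hc h']; ring

theorem saw_sub_saw_right {x y c : ℝ} (hx : x ∈ Ico (0:ℝ) 1) (hy : y ∈ Ico (0:ℝ) 1)
    (hc : c ∈ Ico (0:ℝ) 1) (hxy : x < y) (h : x < c → y < c) :
    saw (y - c) - saw (x - c) = y - x - if x = c then 1 / 2 else 0 := by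
  rcases lt_trichotomy x c with h' | rfl | h'
  · rw [if_neg h'.ne, saw_sub_saw_of_same_side hy hx hc (.inr ⟨h h', h'⟩), sub_zero]
  · rw [if_pos rfl, saw_of_lt hy hc hxy]
    simp [saw]
  · rw [if_neg h'.ne', saw_sub_saw_of_same_side hy hx hc (.inl ⟨h'.trans hxy, h'⟩), sub_zero]

theorem two_le_den {β : ℚ} (hβ : β ∈ Ico (0:ℚ) 1) (h0 : β ≠ 0) : 2 ≤ β.den := by
  by_contra! h
  have h1 : β.den = 1 := by have := β.den_pos; omega
  obtain ⟨h2, h3⟩ := hβ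
  rw [← Rat.den_eq_one_iff β |>.1 h1] at h2 h3 h0
  norm_cast at h2 h3 h0
  omega

theorem num_mul_inv_num {β : ℚ} :
    ((β.num : ℤ) : ZMod β.den) * (β.num : ZMod β.den)⁻¹ = 1 := by
  apply ZMod.mul_inv_of_unit
  rw [ZMod.coe_int_isUnit_iff_isCoprime, Int.isCoprime_iff_nat_coprime]
  exact β.reduced.symm

theorem lden_spec {β : ℚ} (hβ : 2 ≤ β.den) :
    0 < lden β ∧ lden β < β.den ∧ (β.den : ℤ) ∣ β.num * lden β - 1 := by
  have : Fact (1 < β.den) := ⟨hβ⟩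
  have : NeZero β.den := ⟨by omega⟩
  refine ⟨Nat.pos_of_ne_zero fun h => ?_, ZMod.val_lt _, ?_⟩
  · have hu := num_mul_inv_num (β := β)
    rw [lden, ZMod.val_eq_zero] at h
    rw [h, mul_zero] at hu
    exact zero_ne_one hu
  · rw [← ZMod.intCast_zmod_eq_zero_iff_dvd]
    push_cast
    rw [lden, ZMod.natCast_zmod_val, num_mul_inv_num, sub_self]

theorem rden_eq {β : ℚ} (hβ : 2 ≤ β.den) : rden β = β.den - lden β := by
  have : NeZero β.den := ⟨by omega⟩
  have h := (lden_spec hβ).1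
  have hinv : (((-β.num : ℤ) : ZMod β.den)⁻¹) = -(β.num : ZMod β.den)⁻¹ := by
    have h1 := num_mul_inv_num (β := β)
    have h2 : ((-β.num : ℤ) : ZMod β.den) * ((-β.num : ℤ) : ZMod β.den)⁻¹ = 1 := by
      apply ZMod.mul_inv_of_unit
      rw [Int.cast_neg]
      exact (IsUnit.of_mul_eq_one _ h1).neg
    set v := (((-β.num : ℤ) : ZMod β.den)⁻¹)
    push_cast at h2
    linear_combination (-v) * h1 - (β.num : ZMod β.den)⁻¹ * h2
  rw [rden, hinv, ZMod.neg_val, if_neg, lden]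
  intro h'
  rw [lden, h', ZMod.val_zero] at h
  exact h.ne rfl

theorem den_lpt {β : ℚ} (hβ : 2 ≤ β.den) : (lpt β).den = lden β := by
  obtain ⟨h1, -, k, hk⟩ := lden_spec hβ
  have hq : (β.den : ℚ) ≠ 0 := by exact_mod_cast β.den_nz
  have : lpt β = (k : ℚ) / ((lden β : ℤ) : ℚ) := by
    rw [lpt, hk]; push_cast; rw [mul_div_mul_left _ _ hq]
  have h := Rat.den_div_eq_of_coprime (a := k) (b := lden β) (by exact_mod_cast h1)
    (Int.isCoprime_iff_nat_coprime.1 ⟨-β.den, β.num, by linarith⟩)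
  rw [this]; exact_mod_cast h

theorem den_rpt {β : ℚ} (hβ : 2 ≤ β.den) : (rpt β).den = rden β := by
  obtain ⟨-, h1, k, hk⟩ := lden_spec hβ
  have hr : (rden β : ℤ) = β.den - lden β := by rw [rden_eq hβ]; omega
  have hk' : β.num * (rden β : ℤ) + 1 = β.den * (β.num - k) := by rw [hr]; linarith
  have hq : (β.den : ℚ) ≠ 0 := by exact_mod_cast β.den_nz
  have : rpt β = ((β.num - k : ℤ) : ℚ) / ((rden β : ℤ) : ℚ) := by
    rw [rpt, hk']; push_cast; rw [mul_div_mul_left _ _ hq]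
  have h := Rat.den_div_eq_of_coprime (a := β.num - k) (b := rden β) (by omega)
    (Int.isCoprime_iff_nat_coprime.1 ⟨β.den, -β.num, by linarith⟩)
  rw [this]; exact_mod_cast h

theorem den_lpt_add_den_rpt {β : ℚ} (hβ : 2 ≤ β.den) :
    (lpt β).den + (rpt β).den = β.den := by
  have := (lden_spec hβ).2.1
  rw [den_lpt hβ, den_rpt hβ, rden_eq hβ]; omega

theorem fract_lpt_ne {β : ℚ} (hβ : 2 ≤ β.den) : Int.fract (lpt β) ≠ β := fun h => by
  have h1 := Rat.den_intFract (lpt β)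
  have h2 := den_lpt_add_den_rpt hβ
  have h3 := (rpt β).den_pos
  rw [h] at h1; omega

theorem fract_rpt_ne {β : ℚ} (hβ : 2 ≤ β.den) : Int.fract (rpt β) ≠ β := fun h => by
  have h1 := Rat.den_intFract (rpt β)
  have h2 := den_lpt_add_den_rpt hβ
  have h3 := (lpt β).den_pos
  rw [h] at h1; omega

theorem cast_mem_Ico {r : ℚ} (h : r ∈ Ico (0:ℚ) 1) : (r : ℝ) ∈ Ico (0:ℝ) 1 :=
  ⟨by exact_mod_cast h.1, by exact_mod_cast h.2⟩

theorem fract_mem_Ico (r : ℚ) : Int.fract r ∈ Ico (0:ℚ) 1 :=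
  ⟨Int.fract_nonneg r, Int.fract_lt_one r⟩

theorem fb_eq {β : ℚ} (h0 : β ≠ 0) (x : ℝ) :
    fb β x = β.den * saw (x - β) - (lpt β).den * saw (x - (Int.fract (lpt β) : ℚ))
      - (rpt β).den * saw (x - (Int.fract (rpt β) : ℚ)) := by
  rw [fb, if_neg h0, Rat.cast_fract, Rat.cast_fract, saw_sub_fract, saw_sub_fract]

/-- `fb β` takes the same value at points not separated by `β` and its Farey neighbours. -/
theorem fb_eq_fb {β : ℚ} (hβ : β ∈ Ico (0:ℚ) 1) (h0 : β ≠ 0) {x y : ℝ}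
    (hx : x ∈ Ico (0:ℝ) 1) (hy : y ∈ Ico (0:ℝ) 1)
    (h : ∀ c : ℚ, c = β ∨ c = Int.fract (lpt β) ∨ c = Int.fract (rpt β) →
      ((c : ℝ) < x ∧ (c : ℝ) < y) ∨ (x < c ∧ y < c)) :
    fb β x = fb β y := by
  have hd : ((lpt β).den : ℝ) + (rpt β).den = β.den := by
    exact_mod_cast den_lpt_add_den_rpt (two_le_den hβ h0)
  have h1 := saw_sub_saw_of_same_side hx hy (cast_mem_Ico hβ) (h _ (.inl rfl))
  have h2 := saw_sub_saw_of_same_side hx hy (cast_mem_Ico (fract_mem_Ico _))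
    (h _ (.inr (.inl rfl)))
  have h3 := saw_sub_saw_of_same_side hx hy (cast_mem_Ico (fract_mem_Ico _))
    (h _ (.inr (.inr rfl)))
  rw [fb_eq h0, fb_eq h0]
  linear_combination (β.den : ℝ) * h1 - (lpt β).den * h2 - (rpt β).den * h3 - (x - y) * hd

/-- `fb β` jumps to the right of each Farey neighbour of `β`. -/
theorem fb_lt_fb {β : ℚ} (hβ : β ∈ Ico (0:ℚ) 1) (h0 : β ≠ 0) {c : ℚ}
    (hc : c = Int.fract (lpt β) ∨ c = Int.fract (rpt β)) {y : ℝ}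
    (hy : y ∈ Ico (0:ℝ) 1) (hcy : (c : ℝ) < y)
    (h : ∀ d : ℚ, d = β ∨ d = Int.fract (lpt β) ∨ d = Int.fract (rpt β) →
      (c : ℝ) < d → y < d) :
    fb β c < fb β y := by
  have h2β := two_le_den hβ h0
  have hd : ((lpt β).den : ℝ) + (rpt β).den = β.den := by
    exact_mod_cast den_lpt_add_den_rpt h2β
  have hcβ : (c : ℝ) ≠ β := by
    rcases hc with rfl | rfl
    · exact_mod_cast fract_lpt_ne h2β
    · exact_mod_cast fract_rpt_ne h2β
  have hcI : (c : ℝ) ∈ Ico (0:ℝ) 1 := by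
    rcases hc with rfl | rfl <;> exact cast_mem_Ico (fract_mem_Ico _)
  have h1 := saw_sub_saw_right hcI hy (cast_mem_Ico hβ) hcy (h _ (.inl rfl))
  have h2 := saw_sub_saw_right hcI hy (cast_mem_Ico (fract_mem_Ico _)) hcy
    (h _ (.inr (.inl rfl)))
  have h3 := saw_sub_saw_right hcI hy (cast_mem_Ico (fract_mem_Ico _)) hcy
    (h _ (.inr (.inr rfl)))
  rw [if_neg hcβ] at h1
  have hl : (0:ℝ) < (lpt β).den := by exact_mod_cast (lpt β).den_pos
  have hr : (0:ℝ) < (rpt β).den := by exact_mod_cast (rpt β).den_pos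
  have key : fb β y - fb β c =
      (lpt β).den * (if (c : ℝ) = (Int.fract (lpt β) : ℚ) then 1 / 2 else 0) +
      (rpt β).den * (if (c : ℝ) = (Int.fract (rpt β) : ℚ) then 1 / 2 else 0) := by
    rw [fb_eq h0, fb_eq h0]
    linear_combination (β.den : ℝ) * h1 - (lpt β).den * h2 - (rpt β).den * h3 - (y - c) * hd
  rw [← sub_pos, key]
  rcases hc with rfl | rfl
  · rw [if_pos rfl]
    split_ifs <;> positivity
  · rw [if_pos rfl]
    split_ifs <;> positivity

theorem mem_iff_mem_of_generateFrom {α : Type*} {G : Set (Set α)} {x y : α}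
    (h : ∀ g ∈ G, x ∈ g ↔ y ∈ g) {s : Set α}
    (hs : MeasurableSet[MeasurableSpace.generateFrom G] s) : x ∈ s ↔ y ∈ s := by
  induction s, hs using MeasurableSpace.generateFrom_induction with
  | hC t ht _ => exact h t ht
  | empty => simp
  | compl t _ ih => simpa using not_congr ih
  | iUnion f _ ih => simp [ih]

/-- A function constant on the pieces of a countable measurable cover of the space is
measurable. -/
theorem measurable_of_constant_on_cover {α β : Type*} {m : MeasurableSpace α}
    [MeasurableSpace β] {f : α → β} {C : Set (Set α)} (hC : C.Countable)
    (hm : ∀ s ∈ C, MeasurableSet s) (hcover : ∀ x, ∃ s ∈ C, x ∈ s)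
    (hf : ∀ s ∈ C, ∀ x ∈ s, ∀ y ∈ s, f x = f y) : Measurable f := by
  intro t _
  have : f ⁻¹' t = ⋃₀ {s ∈ C | s ⊆ f ⁻¹' t} := by
    ext x
    constructor
    · intro hx
      obtain ⟨s, hs, hxs⟩ := hcover x
      refine ⟨s, ⟨hs, fun y hy => ?_⟩, hxs⟩
      rw [mem_preimage, hf s hs y hy x hxs]
      exact hx
    · rintro ⟨s, ⟨_, hs⟩, hxs⟩
      exact hs hxs
  rw [this]
  exact MeasurableSet.sUnion (hC.mono (sep_subset _ _)) fun s hs => hm s hs.1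

theorem countable_isCircComponent (S : Finset ℚ) : {J | isCircComponent S J}.Countable := by
  refine (((S ×ˢ S).countable_toSet.image
    fun p => Ioo ((p.1 : ℚ) : ℝ) ((p.2 : ℚ) : ℝ)).union
    ((S ×ˢ S).countable_toSet.image
      fun p => Ioo ((p.1 : ℚ) : ℝ) 1 ∪ Ico 0 ((p.2 : ℚ) : ℝ))).mono ?_
  rintro J (⟨a, ha, b, hb, -, -, rfl⟩ | ⟨a, ha, b, hb, -, rfl⟩)
  · exact .inl ⟨(a, b), by simp [ha, hb], rfl⟩
  · exact .inr ⟨(a, b), by simp [ha, hb], rfl⟩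

theorem exists_isCircComponent_mem {S : Finset ℚ} (hS : ∀ c ∈ S, c ∈ Ico (0:ℚ) 1)
    (h0 : 0 ∈ S) {x : ℝ} (hx : x ∈ Ico (0:ℝ) 1) (hxS : ∀ c ∈ S, (c : ℝ) ≠ x) :
    ∃ J, isCircComponent S J ∧ x ∈ J := by
  classical
  have hl : (S.filter fun c : ℚ => (c : ℝ) < x).Nonempty :=
    ⟨0, Finset.mem_filter.2 ⟨h0, lt_of_le_of_ne (by simpa using hx.1) (hxS 0 h0)⟩⟩
  obtain ⟨a, ha, hamax⟩ := Finset.exists_max_image _ id hl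
  rw [Finset.mem_filter] at ha
  simp only [id, Finset.mem_filter, and_imp] at hamax
  by_cases hr : (S.filter fun c : ℚ => x < (c : ℝ)).Nonempty
  · obtain ⟨b, hb, hbmin⟩ := Finset.exists_min_image _ id hr
    rw [Finset.mem_filter] at hb
    simp only [id, Finset.mem_filter, and_imp] at hbmin
    refine ⟨_, .inl ⟨a, ha.1, b, hb.1, by exact_mod_cast ha.2.trans hb.2, fun c hc => ?_, rfl⟩,
      ha.2, hb.2⟩
    exact (lt_or_gt_of_ne (hxS c hc)).imp (hamax c hc) (hbmin c hc)
  · refine ⟨_, .inr ⟨a, ha.1, 0, h0, fun c hc => ⟨(hS c hc).1, ?_⟩, rfl⟩, .inl ⟨ha.2, hx.2⟩⟩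
    refine (lt_or_gt_of_ne (hxS c hc)).elim (hamax c hc) fun h => ?_
    exact (hr ⟨c, Finset.mem_filter.2 ⟨hc, h⟩⟩).elim

theorem lt_or_gt_of_mem_isCircComponent {S : Finset ℚ} (hS : ∀ c ∈ S, c ∈ Ico (0:ℚ) 1)
    (h0 : 0 ∈ S) {J : Set ℝ} (hJ : isCircComponent S J) {x y : ℝ} (hx : x ∈ J) (hy : y ∈ J)
    {c : ℚ} (hc : c ∈ S) : ((c : ℝ) < x ∧ (c : ℝ) < y) ∨ (x < c ∧ y < c) := by
  rcases hJ with ⟨a, -, b, -, -, h, rfl⟩ | ⟨a, -, b, hb, h, rfl⟩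
  · rcases h c hc with h | h
    · have h : (c : ℝ) ≤ a := by exact_mod_cast h
      exact .inl ⟨h.trans_lt hx.1, h.trans_lt hy.1⟩
    · have h : (b : ℝ) ≤ c := by exact_mod_cast h
      exact .inr ⟨hx.2.trans_le h, hy.2.trans_le h⟩
  · obtain rfl : b = 0 := le_antisymm (h 0 h0).1 (hS b hb).1
    have h : (c : ℝ) ≤ a := by exact_mod_cast (h c hc).2
    simp only [Rat.cast_zero, Ico_self, union_empty] at hx hy
    exact .inl ⟨h.trans_lt hx.1, h.trans_lt hy.1⟩

theorem measurable_fb_of_neighbours_mem {e : ℕ → ℚ} (he : IsEnumeration e) (h1 : e 1 = 0) {n : ℕ}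
    (hn : 1 ≤ n) (h0 : e n ≠ 0) (hl : Int.fract (lpt (e n)) ∈ (Finset.Icc 1 n).image e)
    (hr : Int.fract (rpt (e n)) ∈ (Finset.Icc 1 n).image e) :
    @Measurable (Ico (0:ℝ) 1) ℝ (MeasurableSpace.comap Subtype.val (bsig e n))
      Real.measurableSpace (fun x => fb (e n) (x : ℝ)) := by
  have hS : ∀ c ∈ (Finset.Icc 1 n).image e, c ∈ Ico (0:ℚ) 1 := by
    simp only [Finset.mem_image, Finset.mem_Icc]
    rintro _ ⟨k, hk, rfl⟩
    exact he.1 k hk.1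
  have hS0 : 0 ∈ (Finset.Icc 1 n).image e :=
    Finset.mem_image.2 ⟨1, Finset.mem_Icc.2 ⟨le_rfl, hn⟩, h1⟩
  set G : Set (Set ℝ) := {J | isCircComponent ((Finset.Icc 1 n).image e) J} ∪
     {J | ∃ k, 1 ≤ k ∧ k ≤ n ∧ J = {((e k : ℚ) : ℝ)}} with hG
  have hGc : G.Countable := by
    refine (countable_isCircComponent _).union ((countable_range fun k => {((e k : ℚ) : ℝ)}).mono ?_)
    rintro _ ⟨k, -, -, rfl⟩
    exact ⟨k, rfl⟩
  refine @measurable_of_constant_on_cover _ _ (MeasurableSpace.comap Subtype.val (bsig e n))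
    _ _ (preimage Subtype.val '' G) (hGc.image _) ?_ ?_ ?_
  · rintro _ ⟨J, hJ, rfl⟩
    exact ⟨J, MeasurableSpace.measurableSet_generateFrom hJ, rfl⟩
  · intro x
    by_cases hx : ∀ c ∈ (Finset.Icc 1 n).image e, (c : ℝ) ≠ x
    · obtain ⟨J, hJ, hxJ⟩ := exists_isCircComponent_mem hS hS0 x.2 hx
      exact ⟨_, ⟨J, .inl hJ, rfl⟩, hxJ⟩
    · push Not at hx
      obtain ⟨c, hc, hcx⟩ := hx
      obtain ⟨k, hk, rfl⟩ := Finset.mem_image.1 hc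
      rw [Finset.mem_Icc] at hk
      exact ⟨_, ⟨_, .inr ⟨k, hk.1, hk.2, rfl⟩, rfl⟩, hcx.symm⟩
  · rintro _ ⟨J, hJ | ⟨k, -, -, rfl⟩, rfl⟩ x hx y hy
    · refine fb_eq_fb (he.1 n hn) h0 x.2 y.2 fun c hc =>
        lt_or_gt_of_mem_isCircComponent hS hS0 hJ hx hy ?_
      rcases hc with rfl | rfl | rfl
      · exact Finset.mem_image_of_mem _ (Finset.mem_Icc.2 ⟨hn, le_rfl⟩)
      · exact hl
      · exact hr
    · rw [show (x : ℝ) = y from (mem_singleton_iff.1 hx).trans (mem_singleton_iff.1 hy).symm]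

theorem exists_right_near (S : Finset ℚ) {x : ℝ} (hx : x < 1) :
    ∃ y, x < y ∧ y < 1 ∧ ∀ c ∈ S, x < (c : ℝ) → y < c := by
  have h : ∀ᶠ y in nhdsWithin x (Ioi x), x < y ∧ y < 1 ∧ ∀ c ∈ S, x < (c : ℝ) → y < c := by
    refine Filter.Eventually.and self_mem_nhdsWithin (((eventually_lt_nhds hx).filter_mono nhdsWithin_le_nhds).and
      ((Filter.eventually_all_finset S).2 fun c _ => ?_))
    by_cases hc : x < (c : ℝ)
    · filter_upwards [(eventually_lt_nhds hc).filter_mono nhdsWithin_le_nhds] with y hy _ using hy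
    · exact .of_forall fun y h => (hc h).elim
  exact h.exists

theorem neighbour_mem_of_measurable_fb {e : ℕ → ℚ} (he : IsEnumeration e) {n : ℕ}
    (hn : 1 ≤ n) (h0 : e n ≠ 0)
    (hm : @Measurable (Ico (0:ℝ) 1) ℝ (MeasurableSpace.comap Subtype.val (bsig e n))
      Real.measurableSpace (fun x => fb (e n) (x : ℝ))) {c : ℚ}
    (hc : c = Int.fract (lpt (e n)) ∨ c = Int.fract (rpt (e n))) :
    ∃ k, 1 ≤ k ∧ k ≤ n ∧ e k = c := by
  classical
  by_contra! hcS
  have hcI : (c : ℝ) ∈ Ico (0:ℝ) 1 := by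
    rcases hc with rfl | rfl <;> exact cast_mem_Ico (fract_mem_Ico _)
  obtain ⟨y, hcy, hy1, hy⟩ := exists_right_near ((Finset.Icc 1 n).image e ∪
    {e n, Int.fract (lpt (e n)), Int.fract (rpt (e n))}) hcI.2
  have hyI : y ∈ Ico (0:ℝ) 1 := ⟨hcI.1.trans hcy.le, hy1⟩
  have hlt := fb_lt_fb (he.1 n hn) h0 hc hyI hcy fun d hd =>
    hy d (Finset.mem_union_right _ (by simpa using hd))
  have hne : ∀ d ∈ (Finset.Icc 1 n).image e, (d < c ∧ (d : ℝ) < y) ∨ (c < d ∧ y < (d : ℝ)) := by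
    intro d hd
    have hdc : d ≠ c := by
      obtain ⟨k, hk, rfl⟩ := Finset.mem_image.1 hd
      rw [Finset.mem_Icc] at hk
      exact hcS k hk.1 hk.2
    refine (lt_or_gt_of_ne hdc).imp (fun h => ⟨h, ?_⟩) fun h => ⟨h, ?_⟩
    · exact lt_trans (by exact_mod_cast h) hcy
    · exact hy d (Finset.mem_union_left _ hd) (by exact_mod_cast h)
  have hl : ∀ d ∈ (Finset.Icc 1 n).image e, ((d : ℝ) < c ↔ (d : ℝ) < y) := fun d hd => by
    rw [Rat.cast_lt]
    rcases hne d hd with h | h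
    · simp [h]
    · simp [h.1.not_gt, h.2.not_gt]
  have hr : ∀ d ∈ (Finset.Icc 1 n).image e, ((c : ℝ) < d ↔ y < d) := fun d hd => by
    rw [Rat.cast_lt]
    rcases hne d hd with h | h
    · simp [h.1.not_gt, h.2.not_gt]
    · simp [h]
  obtain ⟨s, hs, hs'⟩ := hm (measurableSet_singleton (fb (e n) c))
  have hmem := mem_iff_mem_of_generateFrom (x := (c : ℝ)) (y := y) (fun g hg => ?_) hs
  · have h1 : (⟨c, hcI⟩ : Ico (0:ℝ) 1) ∈ Subtype.val ⁻¹' s := by rw [hs']; rfl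
    have h2 : (⟨y, hyI⟩ : Ico (0:ℝ) 1) ∈ Subtype.val ⁻¹' s := hmem.1 h1
    rw [hs'] at h2
    exact hlt.ne' h2
  · rcases hg with (⟨a, ha, b, hb, -, -, rfl⟩ | ⟨a, ha, b, hb, -, rfl⟩) | ⟨k, hk, hkn, rfl⟩
    · simp only [mem_Ioo, hl a ha, hr b hb]
    · simp only [mem_union, mem_Ioo, mem_Ico, hl a ha, hr b hb, hcI.1, hcI.2, hyI.1, hyI.2]
    · have hk' : e k ∈ (Finset.Icc 1 n).image e :=
        Finset.mem_image_of_mem _ (Finset.mem_Icc.2 ⟨hk, hkn⟩)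
      simp only [mem_singleton_iff, le_antisymm_iff, ← not_lt, hl _ hk', hr _ hk']

/-- **Theorem 6 (Haynes–Vaaler).**  An enumeration `β₁, β₂, …` of `ℚ/ℤ` is admissible if
and only if for each `n ≥ 1` the function `f_{β_n}` (restricted to the circle
`[0,1) ≅ ℝ/ℤ`) is measurable with respect to the σ-algebra `B_n`. -/
theorem admissible_iff_measurable (e : ℕ → ℚ) (he : IsEnumeration e) :
    IsAdmissible e ↔
      ∀ n : ℕ, 1 ≤ n →
        @Measurable (Set.Ico (0:ℝ) 1) ℝ (MeasurableSpace.comap Subtype.val (bsig e n))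
          Real.measurableSpace (fun x => fb (e n) (x : ℝ)) := by
  have hne : e 1 = 0 → ∀ n, 2 ≤ n → e n ≠ 0 := fun h1 n hn h => by
    have := he.2.1 n 1 (by omega) le_rfl (h.trans h1.symm)
    omega
  constructor
  · rintro ⟨h1, hl, hr⟩ n hn
    obtain rfl | hn2 := hn.eq_or_lt
    · simp only [h1, fb, if_true]
      exact @measurable_const _ _ _ (MeasurableSpace.comap Subtype.val (bsig e 1)) _
    · refine measurable_fb_of_neighbours_mem he h1 hn (hne h1 n hn2) ?_ ?_
      · obtain ⟨k, hk, hek⟩ := he.2.2 _ (fract_mem_Ico (lpt (e n)))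
        exact Finset.mem_image.2 ⟨k, Finset.mem_Icc.2 ⟨hk, (hl n hn2 k hk hek).le⟩, hek⟩
      · obtain ⟨k, hk, hek⟩ := he.2.2 _ (fract_mem_Ico (rpt (e n)))
        exact Finset.mem_image.2 ⟨k, Finset.mem_Icc.2 ⟨hk, (hr n hn2 k hk hek).le⟩, hek⟩
  · intro hm
    have hlt : ∀ n, 1 ≤ n → e n ≠ 0 → ∀ c, c = Int.fract (lpt (e n)) ∨ c = Int.fract (rpt (e n)) →
        ∃ k, 1 ≤ k ∧ k < n ∧ e k = c := by
      intro n hn h0 c hc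
      obtain ⟨k, hk, hkn, hek⟩ := neighbour_mem_of_measurable_fb he hn h0 (hm n hn) hc
      refine ⟨k, hk, lt_of_le_of_ne hkn ?_, hek⟩
      rintro rfl
      have h2 := two_le_den (he.1 k hn) h0
      exact hc.elim (fun h => fract_lpt_ne h2 (h.symm.trans hek.symm))
        fun h => fract_rpt_ne h2 (h.symm.trans hek.symm)
    have h1 : e 1 = 0 := by
      by_contra h0
      obtain ⟨k, hk, hk1, -⟩ := hlt 1 le_rfl h0 _ (.inl rfl)
      omega
    refine ⟨h1, fun m hm2 k hk hek => ?_, fun m hm2 k hk hek => ?_⟩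
    · obtain ⟨j, hj, hjm, hej⟩ := hlt m (by omega) (hne h1 m hm2) _ (.inl rfl)
      rwa [he.2.1 k j hk hj (hek.trans hej.symm)]
    · obtain ⟨j, hj, hjm, hej⟩ := hlt m (by omega) (hne h1 m hm2) _ (.inr rfl)
      rwa [he.2.1 k j hk hj (hek.trans hej.symm)]

end
end
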